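/- Let 0 < T₁ ≤ T₂, let ρ : [0,1] → [0,∞) be measurable and bounded with ∫₀¹ ρ = 1, let T : [0,1] → (0,∞) be measurable with T₁ ≤ T(y) ≤ T₂ for all y, and let f be a mild steady state of the linear BGK equation with data (κ, T₁, T₂, ρ, T) where κ = 1. Then there exists a constant C depending only on T₁ and T₂ such that for all x₁, x₂ ∈ [0,1], |ρ(x₂) − ρ(x₁)| ≤ C (1 + sup_{y∈[0,1]} ρ(y)) √|x₂ − x₁|; i.e. the spatial density of the steady state is 1/2-Hölder continuous. -/

import Mathlib

open MeasureTheory Real Set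

/-- Centered Maxwellian with temperature `T`: `M_T(v) = (2πT)^{-1/2} exp(−v²/(2T))`. -/
noncomputable def Mxw (T v : ℝ) : ℝ :=
  (Real.sqrt (2 * π * T))⁻¹ * Real.exp (-v ^ 2 / (2 * T))

/-- Wall Maxwellian with temperature `T`: `M̃_T(v) = (1/T) exp(−v²/(2T))`,
normalized so that `∫₀^∞ v M̃_T(v) dv = 1`. -/
noncomputable def wallMxw (T v : ℝ) : ℝ :=
  T⁻¹ * Real.exp (-v ^ 2 / (2 * T))

/-- `C_i = ∫₀^∞ v e^{−1/(κv)} M̃_{T_i}(v) dv`. -/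
noncomputable def Cwall (κ T : ℝ) : ℝ :=
  ∫ v in Ioi (0 : ℝ), v * Real.exp (-1 / (κ * v)) * wallMxw T v

/-- `C₋ = (1/κ) ∫₀¹ ρ(y) (∫₀^∞ e^{−y/(κv)} M_{T(y)}(v) dv) dy`. -/
noncomputable def Cminus (κ : ℝ) (ρ T : ℝ → ℝ) : ℝ :=
  κ⁻¹ * ∫ y in Icc (0 : ℝ) 1, ρ y * ∫ v in Ioi (0 : ℝ), Real.exp (-y / (κ * v)) * Mxw (T y) v

/-- `C₊ = (1/κ) ∫₀¹ ρ(y) (∫₀^∞ e^{−(1−y)/(κv)} M_{T(y)}(v) dv) dy`. -/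
noncomputable def Cplus (κ : ℝ) (ρ T : ℝ → ℝ) : ℝ :=
  κ⁻¹ * ∫ y in Icc (0 : ℝ) 1, ρ y * ∫ v in Ioi (0 : ℝ), Real.exp (-(1 - y) / (κ * v)) * Mxw (T y) v

/-- `f` is a mild steady state of the linear BGK equation with data `(κ, T₁, T₂, ρ, T)`. -/
def IsMildSteadyState (κ T₁ T₂ : ℝ) (ρ T : ℝ → ℝ) (f : ℝ → ℝ → ℝ) : Prop :=
  Cwall κ T₁ * Cwall κ T₂ < 1 ∧
  IntegrableOn
    (fun y => ρ y * ∫ v in Ioi (0 : ℝ), Real.exp (-y / (κ * v)) * Mxw (T y) v)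
    (Icc (0 : ℝ) 1) ∧
  IntegrableOn
    (fun y => ρ y * ∫ v in Ioi (0 : ℝ), Real.exp (-(1 - y) / (κ * v)) * Mxw (T y) v)
    (Icc (0 : ℝ) 1) ∧
  (∀ x ∈ Icc (0 : ℝ) 1, ρ x = ∫ v, f x v) ∧
  (∀ x ∈ Icc (0 : ℝ) 1,
    (∀ᵐ v ∂(volume.restrict (Ioi (0 : ℝ))),
      f x v = Real.exp (-x / (κ * v)) * wallMxw T₁ v *
          ((Cminus κ ρ T + Cwall κ T₂ * Cplus κ ρ T) / (1 - Cwall κ T₁ * Cwall κ T₂)) +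
        ∫ y in (0 : ℝ)..x, (κ * v)⁻¹ * Real.exp (-(x - y) / (κ * v)) * ρ y * Mxw (T y) v) ∧
    (∀ᵐ v ∂(volume.restrict (Iio (0 : ℝ))),
      f x v = Real.exp (-(1 - x) / (κ * |v|)) * wallMxw T₂ v *
          ((Cplus κ ρ T + Cwall κ T₁ * Cminus κ ρ T) / (1 - Cwall κ T₁ * Cwall κ T₂)) +
        ∫ y in x..1, (κ * |v|)⁻¹ * Real.exp (-(y - x) / (κ * |v|)) * ρ y * Mxw (T y) v))

/-- The solution at `x` of `u f' + f = ρ M_T` on `[0, x]` with inflow `A · wallMxw Tw` at `0`,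
for a positive velocity `u`. -/
noncomputable def mildHalf (ρ T : ℝ → ℝ) (Tw A x u : ℝ) : ℝ :=
  Real.exp (-x / u) * wallMxw Tw u * A +
    ∫ y in (0 : ℝ)..x, u⁻¹ * Real.exp (-(x - y) / u) * (ρ y * Mxw (T y) u)

lemma one_sub_exp_neg_le_sqrt {t : ℝ} (ht : 0 ≤ t) : 1 - Real.exp (-t) ≤ √t := by
  have h1 := Real.add_one_le_exp (-t)
  have h2 := Real.exp_pos (-t)
  have h3 := Real.sq_sqrt ht
  have h4 := Real.sqrt_nonneg t
  by_cases h : √t ≤ 1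
  · nlinarith
  · linarith

lemma intervalIntegral_exp_kernel (u a x : ℝ) :
    ∫ y in a..x, u⁻¹ * Real.exp (-(x - y) / u) = 1 - Real.exp (-(x - a) / u) := by
  have hd : ∀ y ∈ uIcc a x, HasDerivAt (fun y => Real.exp (-(x - y) / u))
      (u⁻¹ * Real.exp (-(x - y) / u)) y := by
    intro y _
    have h1 : HasDerivAt (fun y : ℝ => -(x - y) / u) (u⁻¹) y := by
      have := (((hasDerivAt_id y).const_sub x).neg).div_const u
      simpa using this
    simpa [mul_comm] using h1.exp
  rw [intervalIntegral.integral_eq_sub_of_hasDerivAt hd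
    (Continuous.intervalIntegrable (by fun_prop) _ _)]
  simp

lemma abs_integral_exp_kernel_le {u B : ℝ} (hu : 0 < u) {g : ℝ → ℝ}
    (hB : ∀ y ∈ Icc (0 : ℝ) 1, |g y| ≤ B) {a x : ℝ} (ha : 0 ≤ a) (hax : a ≤ x) (hx : x ≤ 1) :
    |∫ y in a..x, u⁻¹ * Real.exp (-(x - y) / u) * g y| ≤
      B * (1 - Real.exp (-(x - a) / u)) := by
  rw [← intervalIntegral_exp_kernel u a x, ← intervalIntegral.integral_const_mul,
    ← Real.norm_eq_abs]
  refine intervalIntegral.norm_integral_le_of_norm_le hax (.of_forall fun y hy => ?_)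
    ((by fun_prop : Continuous fun y =>
      B * (u⁻¹ * Real.exp (-(x - y) / u))).intervalIntegrable _ _)
  have hk : 0 ≤ u⁻¹ * Real.exp (-(x - y) / u) := by positivity
  rw [Real.norm_eq_abs, abs_mul, abs_of_nonneg hk, mul_comm]
  exact mul_le_mul_of_nonneg_right (hB y ⟨by linarith [hy.1], by linarith [hy.2]⟩) hk

lemma abs_integral_exp_kernel_sub_le {u B : ℝ} (hu : 0 < u) {g : ℝ → ℝ} (hg : Measurable g)
    (hB : ∀ y ∈ Icc (0 : ℝ) 1, |g y| ≤ B) {x₁ x₂ : ℝ} (h₁ : 0 ≤ x₁) (h₁₂ : x₁ ≤ x₂)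
    (h₂ : x₂ ≤ 1) :
    |(∫ y in (0 : ℝ)..x₂, u⁻¹ * Real.exp (-(x₂ - y) / u) * g y) -
      ∫ y in (0 : ℝ)..x₁, u⁻¹ * Real.exp (-(x₁ - y) / u) * g y| ≤
      2 * B * √((x₂ - x₁) / u) := by
  have hB0 : 0 ≤ B := (abs_nonneg _).trans (hB 0 ⟨le_rfl, zero_le_one⟩)
  have hint : ∀ a b : ℝ, 0 ≤ a → a ≤ b → b ≤ 1 → IntervalIntegrable
      (fun y => u⁻¹ * Real.exp (-(x₂ - y) / u) * g y) volume a b := by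
    intro a b ha hab hb
    refine IntervalIntegrable.continuousOn_mul ?_ (by fun_prop)
    rw [intervalIntegrable_iff_integrableOn_Ioc_of_le hab]
    refine Measure.integrableOn_of_bounded (M := B) (by simp) hg.aestronglyMeasurable ?_
    refine (ae_restrict_mem measurableSet_Ioc).mono fun y hy => ?_
    exact hB y ⟨by linarith [hy.1], by linarith [hy.2]⟩
  have hsplit := intervalIntegral.integral_add_adjacent_intervals
    (hint 0 x₁ le_rfl h₁ (h₁₂.trans h₂)) (hint x₁ x₂ h₁ h₁₂ h₂)
  have hfac : (∫ y in (0 : ℝ)..x₁, u⁻¹ * Real.exp (-(x₂ - y) / u) * g y) =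
      Real.exp (-((x₂ - x₁) / u)) *
        ∫ y in (0 : ℝ)..x₁, u⁻¹ * Real.exp (-(x₁ - y) / u) * g y := by
    rw [← intervalIntegral.integral_const_mul]
    congr 1 with y
    rw [show -(x₂ - y) / u = -((x₂ - x₁) / u) + -(x₁ - y) / u by ring, Real.exp_add]
    ring
  have hnew := abs_integral_exp_kernel_le hu hB h₁ h₁₂ h₂
  have hold := abs_integral_exp_kernel_le hu hB le_rfl h₁ (h₁₂.trans h₂)
  rw [← hsplit, hfac]
  set I := ∫ y in x₁..x₂, u⁻¹ * Real.exp (-(x₂ - y) / u) * g y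
  set J := ∫ y in (0 : ℝ)..x₁, u⁻¹ * Real.exp (-(x₁ - y) / u) * g y
  have ht : 0 ≤ (x₂ - x₁) / u := div_nonneg (by linarith) hu.le
  have hs := one_sub_exp_neg_le_sqrt ht
  rw [neg_div] at hnew
  set e := Real.exp (-((x₂ - x₁) / u))
  have he1 : e ≤ 1 := Real.exp_le_one_iff.2 (by linarith)
  have hJ : |J| ≤ B := by
    nlinarith [Real.exp_pos (-(x₁ - 0) / u)]
  calc |e * J + I - J| = |I - (1 - e) * J| := by congr 1; ring
    _ ≤ |I| + |(1 - e) * J| := abs_sub _ _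
    _ ≤ B * (1 - e) + (1 - e) * B := by
        rw [abs_mul, abs_of_nonneg (by linarith : 0 ≤ 1 - e)]
        gcongr
    _ ≤ 2 * B * √((x₂ - x₁) / u) := by nlinarith

lemma abs_exp_neg_div_sub_le {u x₁ x₂ : ℝ} (hu : 0 < u) (h₁ : 0 ≤ x₁) (h₁₂ : x₁ ≤ x₂) :
    |Real.exp (-x₂ / u) - Real.exp (-x₁ / u)| ≤ √((x₂ - x₁) / u) := by
  have ht : 0 ≤ (x₂ - x₁) / u := div_nonneg (by linarith) hu.le
  have hs := one_sub_exp_neg_le_sqrt ht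
  have he1 : Real.exp (-((x₂ - x₁) / u)) ≤ 1 := Real.exp_le_one_iff.2 (by linarith)
  have hx1 : Real.exp (-x₁ / u) ≤ 1 :=
    Real.exp_le_one_iff.2 (div_nonpos_of_nonpos_of_nonneg (by linarith) hu.le)
  rw [show -x₂ / u = -x₁ / u + -((x₂ - x₁) / u) by ring, Real.exp_add, abs_sub_comm,
    abs_of_nonneg (by nlinarith [Real.exp_pos (-x₁ / u)])]
  nlinarith [Real.exp_pos (-x₁ / u)]

lemma gaussian_le_gaussian {T T' : ℝ} (hT : 0 < T) (h : T ≤ T') (u : ℝ) :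
    Real.exp (-u ^ 2 / (2 * T)) ≤ Real.exp (-u ^ 2 / (2 * T')) := by
  rw [Real.exp_le_exp, neg_div, neg_div, neg_le_neg_iff]
  gcongr

lemma Mxw_nonneg (T u : ℝ) : 0 ≤ Mxw T u := by
  unfold Mxw; positivity

lemma Mxw_le {T₁ T T₂ : ℝ} (h₁ : 0 < T₁) (h : T₁ ≤ T) (h' : T ≤ T₂) (u : ℝ) :
    Mxw T u ≤ (√(2 * π * T₁))⁻¹ * Real.exp (-u ^ 2 / (2 * T₂)) := by
  unfold Mxw
  have := gaussian_le_gaussian (h₁.trans_le h) h' u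
  gcongr

lemma wallMxw_nonneg {T : ℝ} (hT : 0 < T) (u : ℝ) : 0 ≤ wallMxw T u := by
  unfold wallMxw; positivity

lemma wallMxw_le {T₁ T T₂ : ℝ} (h₁ : 0 < T₁) (h : T₁ ≤ T) (h' : T ≤ T₂) (u : ℝ) :
    wallMxw T u ≤ T₁⁻¹ * Real.exp (-u ^ 2 / (2 * T₂)) := by
  unfold wallMxw
  have := gaussian_le_gaussian (h₁.trans_le h) h' u
  gcongr

lemma measurable_Mxw : Measurable fun p : ℝ × ℝ => Mxw p.1 p.2 := by
  unfold Mxw; fun_prop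

lemma measurable_mildHalf {ρ T : ℝ → ℝ} (hρ : Measurable ρ) (hT : Measurable T) (Tw A : ℝ)
    {x : ℝ} (hx : 0 ≤ x) : Measurable (mildHalf ρ T Tw A x) := by
  unfold mildHalf wallMxw
  refine Measurable.add (by fun_prop) ?_
  simp only [intervalIntegral.integral_of_le hx]
  have hM : Measurable fun p : ℝ × ℝ => Mxw (T p.2) p.1 :=
    measurable_Mxw.comp ((hT.comp measurable_snd).prodMk measurable_fst)
  have : Measurable fun p : ℝ × ℝ =>
      p.1⁻¹ * Real.exp (-(x - p.2) / p.1) * (ρ p.2 * Mxw (T p.2) p.1) := by fun_prop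
  exact this.stronglyMeasurable.integral_prod_right'.measurable

section Bounds

variable {ρ T : ℝ → ℝ} {T₁ T₂ Tw A A' R : ℝ}

lemma abs_mul_Mxw_le (h₁ : 0 < T₁) (hρ0 : ∀ y, 0 ≤ ρ y) (hρR : ∀ y ∈ Icc (0 : ℝ) 1, ρ y ≤ R)
    (hTb : ∀ y ∈ Icc (0 : ℝ) 1, T₁ ≤ T y ∧ T y ≤ T₂) (u : ℝ) :
    ∀ y ∈ Icc (0 : ℝ) 1, |ρ y * Mxw (T y) u| ≤
      R * ((√(2 * π * T₁))⁻¹ * Real.exp (-u ^ 2 / (2 * T₂))) := by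
  intro y hy
  rw [abs_of_nonneg (mul_nonneg (hρ0 y) (Mxw_nonneg _ _))]
  exact mul_le_mul (hρR y hy) (Mxw_le h₁ (hTb y hy).1 (hTb y hy).2 u) (Mxw_nonneg _ _)
    ((hρ0 y).trans (hρR y hy))

lemma abs_mildHalf_le (h₁ : 0 < T₁) (hTw : T₁ ≤ Tw) (hTw' : Tw ≤ T₂) (hA : |A| ≤ A')
    (hρ0 : ∀ y, 0 ≤ ρ y) (hρR : ∀ y ∈ Icc (0 : ℝ) 1, ρ y ≤ R)
    (hTb : ∀ y ∈ Icc (0 : ℝ) 1, T₁ ≤ T y ∧ T y ≤ T₂) {x u : ℝ} (hx : x ∈ Icc (0 : ℝ) 1)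
    (hu : 0 < u) :
    |mildHalf ρ T Tw A x u| ≤
      (T₁⁻¹ * A' + R * (√(2 * π * T₁))⁻¹) * Real.exp (-u ^ 2 / (2 * T₂)) := by
  have hI := abs_integral_exp_kernel_le hu (abs_mul_Mxw_le h₁ hρ0 hρR hTb u) le_rfl hx.1 hx.2
  have hR : 0 ≤ R := (hρ0 0).trans (hρR 0 ⟨le_rfl, zero_le_one⟩)
  have he : Real.exp (-x / u) ≤ 1 :=
    Real.exp_le_one_iff.2 (div_nonpos_of_nonpos_of_nonneg (by linarith [hx.1]) hu.le)
  have hw0 := wallMxw_nonneg (h₁.trans_le hTw) u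
  have hW : |Real.exp (-x / u) * wallMxw Tw u * A| ≤
      1 * (T₁⁻¹ * Real.exp (-u ^ 2 / (2 * T₂))) * A' := by
    rw [abs_mul, abs_of_nonneg (by positivity)]
    have := wallMxw_le h₁ hTw hTw' u
    gcongr
  have hB : 0 ≤ R * ((√(2 * π * T₁))⁻¹ * Real.exp (-u ^ 2 / (2 * T₂))) := by positivity
  refine (abs_add_le _ _).trans ((add_le_add hW hI).trans ?_)
  nlinarith [mul_nonneg hB (Real.exp_pos (-(x - 0) / u)).le]

lemma abs_mildHalf_sub_le_of_le (h₁ : 0 < T₁) (hTw : T₁ ≤ Tw) (hTw' : Tw ≤ T₂) (hA : |A| ≤ A')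
    (hρ : Measurable ρ) (hT : Measurable T)
    (hρ0 : ∀ y, 0 ≤ ρ y) (hρR : ∀ y ∈ Icc (0 : ℝ) 1, ρ y ≤ R)
    (hTb : ∀ y ∈ Icc (0 : ℝ) 1, T₁ ≤ T y ∧ T y ≤ T₂) {x₁ x₂ u : ℝ} (hx₁ : 0 ≤ x₁)
    (h₁₂ : x₁ ≤ x₂) (hx₂ : x₂ ≤ 1) (hu : 0 < u) :
    |mildHalf ρ T Tw A x₂ u - mildHalf ρ T Tw A x₁ u| ≤
      (T₁⁻¹ * A' + 2 * R * (√(2 * π * T₁))⁻¹) *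
        ((√u)⁻¹ * Real.exp (-u ^ 2 / (2 * T₂))) * √(x₂ - x₁) := by
  have hM : Measurable fun y => Mxw (T y) u :=
    measurable_Mxw.comp (hT.prodMk measurable_const)
  have hI := abs_integral_exp_kernel_sub_le (g := fun y => ρ y * Mxw (T y) u) hu (hρ.mul hM)
    (abs_mul_Mxw_le h₁ hρ0 hρR hTb u) hx₁ h₁₂ hx₂
  have hE := abs_exp_neg_div_sub_le hu hx₁ h₁₂
  rw [Real.sqrt_div' _ hu.le] at hI hE
  have hw0 := wallMxw_nonneg (h₁.trans_le hTw) u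
  have hW : |(Real.exp (-x₂ / u) - Real.exp (-x₁ / u)) * wallMxw Tw u * A| ≤
      (√(x₂ - x₁) / √u) * (T₁⁻¹ * Real.exp (-u ^ 2 / (2 * T₂))) * A' := by
    rw [abs_mul, abs_mul, abs_of_nonneg hw0]
    have := wallMxw_le h₁ hTw hTw' u
    gcongr
  unfold mildHalf
  calc _ = |(Real.exp (-x₂ / u) - Real.exp (-x₁ / u)) * wallMxw Tw u * A + _| := by
        congr 1
        rw [add_sub_add_comm, ← sub_mul, ← sub_mul]
    _ ≤ _ := (abs_add_le _ _).trans (add_le_add hW hI)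
    _ = _ := by rw [div_eq_mul_inv]; ring

lemma abs_mildHalf_sub_le (h₁ : 0 < T₁) (hTw : T₁ ≤ Tw) (hTw' : Tw ≤ T₂) (hA : |A| ≤ A')
    (hρ : Measurable ρ) (hT : Measurable T)
    (hρ0 : ∀ y, 0 ≤ ρ y) (hρR : ∀ y ∈ Icc (0 : ℝ) 1, ρ y ≤ R)
    (hTb : ∀ y ∈ Icc (0 : ℝ) 1, T₁ ≤ T y ∧ T y ≤ T₂) {x₁ x₂ u : ℝ}
    (hx₁ : x₁ ∈ Icc (0 : ℝ) 1) (hx₂ : x₂ ∈ Icc (0 : ℝ) 1) (hu : 0 < u) :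
    |mildHalf ρ T Tw A x₂ u - mildHalf ρ T Tw A x₁ u| ≤
      (T₁⁻¹ * A' + 2 * R * (√(2 * π * T₁))⁻¹) *
        ((√u)⁻¹ * Real.exp (-u ^ 2 / (2 * T₂))) * √|x₂ - x₁| := by
  rcases le_total x₁ x₂ with h | h
  · rw [abs_of_nonneg (sub_nonneg.2 h)]
    exact abs_mildHalf_sub_le_of_le h₁ hTw hTw' hA hρ hT hρ0 hρR hTb hx₁.1 h hx₂.2 hu
  · rw [abs_sub_comm, abs_sub_comm x₂, abs_of_nonneg (sub_nonneg.2 h)]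
    exact abs_mildHalf_sub_le_of_le h₁ hTw hTw' hA hρ hT hρ0 hρR hTb hx₂.1 h hx₁.2 hu

end Bounds

/-- The dominating velocity weight `|v|^{-1/2} exp(−v²/(2T))`. -/
lemma integrable_inv_sqrt_abs_mul_gaussian {T : ℝ} (hT : 0 < T) :
    Integrable fun v : ℝ => (√|v|)⁻¹ * Real.exp (-v ^ 2 / (2 * T)) := by
  have hpos : IntegrableOn (fun v : ℝ => (√|v|)⁻¹ * Real.exp (-v ^ 2 / (2 * T))) (Ioi 0) := by
    refine (integrableOn_rpow_mul_exp_neg_mul_sq (b := (2 * T)⁻¹) (by positivity)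
      (s := -(1 / 2)) (by norm_num)).congr_fun (fun v hv => ?_) measurableSet_Ioi
    have hv : 0 < v := hv
    simp only [Real.rpow_neg hv.le, abs_of_pos hv, Real.sqrt_eq_rpow]
    congr 2
    ring
  have hneg : IntegrableOn (fun v : ℝ => (√|v|)⁻¹ * Real.exp (-v ^ 2 / (2 * T))) (Iio 0) := by
    have := hpos.comp_neg
    simpa using this
  rw [← integrableOn_univ, ← Iic_union_Ioi (a := (0 : ℝ))]
  exact ((integrableOn_Iic_iff_integrableOn_Iio (by simp)).2 hneg).union hpos

lemma integrable_gaussian {T : ℝ} (hT : 0 < T) :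
    Integrable fun v : ℝ => Real.exp (-v ^ 2 / (2 * T)) := by
  refine (integrable_exp_neg_mul_sq (b := (2 * T)⁻¹) (by positivity)).congr
    (.of_forall fun v => ?_)
  simp only
  congr 1
  ring

lemma abs_integral_mul_integral_exp_Mxw_le {ρ T a : ℝ → ℝ} {T₁ T₂ : ℝ} (h₁ : 0 < T₁)
    (h₁₂ : T₁ ≤ T₂) (hρ0 : ∀ y, 0 ≤ ρ y) (hρ1 : (∫ y in Icc (0 : ℝ) 1, ρ y) = 1)
    (hTb : ∀ y ∈ Icc (0 : ℝ) 1, T₁ ≤ T y ∧ T y ≤ T₂) (ha : ∀ y ∈ Icc (0 : ℝ) 1, 0 ≤ a y) :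
    |∫ y in Icc (0 : ℝ) 1, ρ y * ∫ v in Ioi (0 : ℝ), Real.exp (-a y / v) * Mxw (T y) v| ≤
      ∫ v in Ioi (0 : ℝ), (√(2 * π * T₁))⁻¹ * Real.exp (-v ^ 2 / (2 * T₂)) := by
  set c := ∫ v in Ioi (0 : ℝ), (√(2 * π * T₁))⁻¹ * Real.exp (-v ^ 2 / (2 * T₂))
  have hρi : IntegrableOn ρ (Icc (0 : ℝ) 1) := integrable_of_integral_eq_one hρ1
  have hc : c = ∫ y in Icc (0 : ℝ) 1, ρ y * c := by
    rw [integral_mul_const, hρ1, one_mul]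
  rw [hc, ← Real.norm_eq_abs]
  refine norm_integral_le_of_norm_le (hρi.mul_const c)
    ((ae_restrict_mem measurableSet_Icc).mono fun y hy => ?_)
  rw [norm_mul, Real.norm_of_nonneg (hρ0 y)]
  refine mul_le_mul_of_nonneg_left ?_ (hρ0 y)
  refine norm_integral_le_of_norm_le
    ((integrable_gaussian (h₁.trans_le h₁₂)).const_mul _).integrableOn
    ((ae_restrict_mem measurableSet_Ioi).mono fun v hv => ?_)
  have he : Real.exp (-a y / v) ≤ 1 := Real.exp_le_one_iff.2
    (div_nonpos_of_nonpos_of_nonneg (by linarith [ha y hy]) (le_of_lt hv))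
  have hM := Mxw_nonneg (T y) v
  rw [Real.norm_of_nonneg (by positivity)]
  exact (mul_le_of_le_one_left hM he).trans (Mxw_le h₁ (hTb y hy).1 (hTb y hy).2 v)

lemma wallMxw_abs (T v : ℝ) : wallMxw T |v| = wallMxw T v := by
  simp [wallMxw]

lemma Mxw_abs (T v : ℝ) : Mxw T |v| = Mxw T v := by
  simp [Mxw]

/-- The leftgoing half of a mild solution is the reflection of a rightgoing one. -/
lemma mildHalf_reflect (ρ T : ℝ → ℝ) (Tw A x v : ℝ) :
    mildHalf (fun y => ρ (1 - y)) (fun y => T (1 - y)) Tw A (1 - x) |v| =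
      Real.exp (-(1 - x) / |v|) * wallMxw Tw v * A +
        ∫ y in x..1, |v|⁻¹ * Real.exp (-(y - x) / |v|) * ρ y * Mxw (T y) v := by
  unfold mildHalf
  rw [wallMxw_abs]
  congr 1
  have := intervalIntegral.integral_comp_sub_left (a := 0) (b := 1 - x)
    (fun y => |v|⁻¹ * Real.exp (-(y - x) / |v|) * ρ y * Mxw (T y) v) 1
  rw [sub_sub_cancel, sub_zero] at this
  rw [← this]
  congr 1 with y
  rw [Mxw_abs, show 1 - x - y = 1 - y - x by ring]
  ring

lemma IsMildSteadyState.ae_eq_mildHalf {T₁ T₂ : ℝ} {ρ T : ℝ → ℝ} {f : ℝ → ℝ → ℝ}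
    (hf : IsMildSteadyState 1 T₁ T₂ ρ T f) {x : ℝ} (hx : x ∈ Icc (0 : ℝ) 1) :
    f x =ᵐ[volume] fun v => if 0 < v then
      mildHalf ρ T T₁ ((Cminus 1 ρ T + Cwall 1 T₂ * Cplus 1 ρ T) /
        (1 - Cwall 1 T₁ * Cwall 1 T₂)) x |v|
      else mildHalf (fun y => ρ (1 - y)) (fun y => T (1 - y)) T₂
        ((Cplus 1 ρ T + Cwall 1 T₁ * Cminus 1 ρ T) /
          (1 - Cwall 1 T₁ * Cwall 1 T₂)) (1 - x) |v| := by
  obtain ⟨hp, hn⟩ := hf.2.2.2.2 x hx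
  rw [ae_restrict_iff' measurableSet_Ioi] at hp
  rw [ae_restrict_iff' measurableSet_Iio] at hn
  filter_upwards [hp, hn, Measure.ae_ne volume (0 : ℝ)] with v hp hn h0
  rcases lt_or_gt_of_ne h0 with h | h
  · rw [hn h, if_neg h.not_gt, mildHalf_reflect]
    simp only [one_mul]
  · rw [hp h, if_pos h, abs_of_pos h]
    simp only [one_mul, mildHalf, mul_assoc]

lemma abs_inflow_le {a b c₁ c₂ c : ℝ} (ha : |a| ≤ c) (hb : |b| ≤ c) :
    |(a + c₂ * b) / (1 - c₁ * c₂)| ≤ c * (1 + |c₁| + |c₂|) / |1 - c₁ * c₂| := by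
  rw [abs_div]
  have : |a + c₂ * b| ≤ c * (1 + |c₁| + |c₂|) := by
    refine (abs_add_le _ _).trans ?_
    rw [abs_mul]
    have hc := (abs_nonneg a).trans ha
    nlinarith [mul_le_mul_of_nonneg_left hb (abs_nonneg c₂), mul_nonneg hc (abs_nonneg c₁)]
  gcongr

/-- the spatial density of the mild steady state is `1/2`-Hölder continuous. -/
theorem density_holder_continuous (T₁ T₂ : ℝ) (hT₁ : 0 < T₁) (hT₁₂ : T₁ ≤ T₂) :
    ∃ C : ℝ, 0 < C ∧
      ∀ ρ T : ℝ → ℝ, Measurable ρ → (∀ y, 0 ≤ ρ y) →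
        (∃ B : ℝ, ∀ y ∈ Icc (0 : ℝ) 1, ρ y ≤ B) →
        (∫ y in Icc (0 : ℝ) 1, ρ y) = 1 →
        Measurable T → (∀ y, 0 < T y) →
        (∀ y ∈ Icc (0 : ℝ) 1, T₁ ≤ T y ∧ T y ≤ T₂) →
        ∀ f : ℝ → ℝ → ℝ, (∀ x v, 0 ≤ f x v) →
          IsMildSteadyState 1 T₁ T₂ ρ T f →
          ∀ x₁ ∈ Icc (0 : ℝ) 1, ∀ x₂ ∈ Icc (0 : ℝ) 1,
            |ρ x₂ - ρ x₁| ≤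
              C * (1 + sSup (ρ '' Icc (0 : ℝ) 1)) * Real.sqrt |x₂ - x₁| := by
  have hT₂ : 0 < T₂ := hT₁.trans_le hT₁₂
  set c := ∫ v in Ioi (0 : ℝ), (√(2 * π * T₁))⁻¹ * Real.exp (-v ^ 2 / (2 * T₂))
  have hc0 : 0 ≤ c := integral_nonneg fun v => by positivity
  set J := ∫ v : ℝ, (√|v|)⁻¹ * Real.exp (-v ^ 2 / (2 * T₂)) with hJ
  have hJ0 : 0 ≤ J := integral_nonneg fun v => by positivity
  set A' := c * (1 + |Cwall 1 T₁| + |Cwall 1 T₂|) / |1 - Cwall 1 T₁ * Cwall 1 T₂| with hA'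
  have hA'0 : 0 ≤ A' := by positivity
  set K := T₁⁻¹ * A' + 2 * (√(2 * π * T₁))⁻¹ with hK
  have hK0 : 0 ≤ K := by positivity
  refine ⟨K * J + 1, by positivity, ?_⟩
  intro ρ T hρ hρ0 ⟨B, hB⟩ hρ1 hT _ hTb f _ hf x₁ hx₁ x₂ hx₂
  set R := sSup (ρ '' Icc (0 : ℝ) 1)
  have hρR : ∀ y ∈ Icc (0 : ℝ) 1, ρ y ≤ R := fun y hy =>
    le_csSup ⟨B, by rintro _ ⟨z, hz, rfl⟩; exact hB z hz⟩ (mem_image_of_mem ρ hy)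
  have hR0 : 0 ≤ R := (hρ0 0).trans (hρR 0 ⟨le_rfl, zero_le_one⟩)
  have hcm : |Cminus 1 ρ T| ≤ c := by
    have := abs_integral_mul_integral_exp_Mxw_le (a := fun y => y) hT₁ hT₁₂ hρ0 hρ1 hTb
      fun y hy => hy.1
    simpa only [Cminus, inv_one, one_mul] using this
  have hcp : |Cplus 1 ρ T| ≤ c := by
    have := abs_integral_mul_integral_exp_Mxw_le (a := fun y => 1 - y) hT₁ hT₁₂ hρ0 hρ1 hTb
      fun y hy => sub_nonneg.2 hy.2
    simpa only [Cplus, inv_one, one_mul] using this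
  have hAp := abs_inflow_le (c₁ := Cwall 1 T₁) (c₂ := Cwall 1 T₂) hcm hcp
  have hAm := abs_inflow_le (c₁ := Cwall 1 T₂) (c₂ := Cwall 1 T₁) hcp hcm
  rw [mul_comm (Cwall 1 T₂), add_right_comm] at hAm
  rw [← hA'] at hAp hAm
  have hrefl : ∀ {y : ℝ}, y ∈ Icc (0 : ℝ) 1 → 1 - y ∈ Icc (0 : ℝ) 1 := fun hy =>
    ⟨sub_nonneg.2 hy.2, sub_le_self _ hy.1⟩
  have hρ' : Measurable fun y => ρ (1 - y) := by fun_prop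
  have hT' : Measurable fun y => T (1 - y) := by fun_prop
  have hint : ∀ x ∈ Icc (0 : ℝ) 1, Integrable (f x) := by
    intro x hx
    refine Integrable.congr ?_ (hf.ae_eq_mildHalf hx).symm
    refine ((integrable_gaussian hT₂).const_mul
      (T₁⁻¹ * A' + R * (√(2 * π * T₁))⁻¹)).mono' ?_ ?_
    · exact (Measurable.ite measurableSet_Ioi
        ((measurable_mildHalf hρ hT _ _ hx.1).comp measurable_abs)
        ((measurable_mildHalf hρ' hT' _ _ (hrefl hx).1).comp measurable_abs)).aestronglyMeasurable
    · filter_upwards [Measure.ae_ne volume (0 : ℝ)] with v hv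
      rw [Real.norm_eq_abs, ← sq_abs v]
      split_ifs
      · exact abs_mildHalf_le hT₁ le_rfl hT₁₂ hAp hρ0 hρR hTb hx (abs_pos.2 hv)
      · exact abs_mildHalf_le hT₁ hT₁₂ le_rfl hAm (fun _ => hρ0 _)
          (fun y hy => hρR _ (hrefl hy)) (fun y hy => hTb _ (hrefl hy)) (hrefl hx) (abs_pos.2 hv)
  set L := T₁⁻¹ * A' + 2 * R * (√(2 * π * T₁))⁻¹ with hL
  have hLK : L ≤ K * (1 + R) := by
    have h1 : 0 ≤ T₁⁻¹ * A' * R := by positivity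
    have h2 : 0 ≤ 2 * (√(2 * π * T₁))⁻¹ := by positivity
    rw [hL, hK]
    nlinarith
  have hdiff : ∀ᵐ v, ‖f x₂ v - f x₁ v‖ ≤
      L * ((√|v|)⁻¹ * Real.exp (-v ^ 2 / (2 * T₂))) * √|x₂ - x₁| := by
    filter_upwards [hf.ae_eq_mildHalf hx₁, hf.ae_eq_mildHalf hx₂,
      Measure.ae_ne volume (0 : ℝ)] with v h1 h2 hv
    rw [h1, h2, Real.norm_eq_abs, ← sq_abs v]
    split_ifs
    · exact abs_mildHalf_sub_le hT₁ le_rfl hT₁₂ hAp hρ hT hρ0 hρR hTb hx₁ hx₂ (abs_pos.2 hv)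
    · have := abs_mildHalf_sub_le hT₁ hT₁₂ le_rfl hAm hρ' hT' (fun _ => hρ0 _)
        (fun y hy => hρR _ (hrefl hy)) (fun y hy => hTb _ (hrefl hy)) (hrefl hx₁) (hrefl hx₂)
        (abs_pos.2 hv)
      rwa [sub_sub_sub_cancel_left, abs_sub_comm x₁] at this
  rw [hf.2.2.2.1 x₁ hx₁, hf.2.2.2.1 x₂ hx₂, ← integral_sub (hint x₂ hx₂) (hint x₁ hx₁)]
  refine (norm_integral_le_of_norm_le
    (((integrable_inv_sqrt_abs_mul_gaussian hT₂).const_mul L).mul_const _) hdiff).trans ?_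
  rw [integral_mul_const, integral_const_mul, ← hJ]
  refine mul_le_mul_of_nonneg_right ?_ (Real.sqrt_nonneg _)
  nlinarith [mul_le_mul_of_nonneg_right hLK hJ0]
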